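/- Let p be an odd prime and let n, k be positive integers with gcd(n, k) = s. If n/s is odd, then gcd(p^n − 1, (p^{2k} + 1)/2) = 1 and gcd(p^n − 1, p^{2k} − p^k + 1) = 1. -/

import Mathlib

theorem aux_two (p n k q m : ℕ) (hp : 0 < p) (a b : ℕ) (ha : Odd a) (hab : k * a = n * b)
    (h1 : q ∣ p ^ n - 1) (hm : (((p : ZMod q) ^ k) ^ m) = -1) : q ∣ 2 := by
  have e : (p : ZMod q) ^ n = 1 := by
    have h := (ZMod.natCast_eq_zero_iff _ _).2 h1
    rw [Nat.cast_sub (Nat.one_le_pow _ _ hp)] at h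
    push_cast at h
    exact sub_eq_zero.1 h
  have h2 : ((p : ZMod q) ^ k) ^ a = 1 := by
    rw [← pow_mul, hab, pow_mul, e, one_pow]
  have h3 : (-1 : ZMod q) = 1 := by
    calc (-1 : ZMod q) = (-1) ^ a := ha.neg_one_pow.symm
      _ = (((p : ZMod q) ^ k) ^ a) ^ m := by rw [← hm, pow_right_comm]
      _ = 1 := by rw [h2, one_pow]
  rw [← ZMod.natCast_eq_zero_iff]
  push_cast
  linear_combination -h3

/-- for `p` an odd prime, `n, k` positive with `gcd(n,k) = s` and `n/s` odd,
`gcd(p^n - 1, (p^{2k}+1)/2) = 1` and `gcd(p^n - 1, p^{2k} - p^k + 1) = 1`. -/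
theorem stmt5 (p n k s : ℕ) (hp : p.Prime) (hodd : Odd p) (hn : 0 < n) (hk : 0 < k)
    (hs : Nat.gcd n k = s) (hns : Odd (n / s)) :
    Nat.gcd (p ^ n - 1) ((p ^ (2 * k) + 1) / 2) = 1 ∧
    Nat.gcd (p ^ n - 1) (p ^ (2 * k) - p ^ k + 1) = 1 := by
  have hab : k * (n / s) = n * (k / s) := by
    subst hs
    rw [← Nat.mul_div_assoc _ (Nat.gcd_dvd_left n k), ← Nat.mul_div_assoc _ (Nat.gcd_dvd_right n k),
      mul_comm]
  obtain ⟨y, hy⟩ : ∃ y, p ^ k = 2 * y + 1 := hodd.pow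
  have hsq : p ^ (2 * k) = 4 * (y * y + y) + 1 := by
    rw [mul_comm, pow_mul, hy]; ring
  have hpar : ∀ N g, g ∣ N → g ∣ 2 → Odd N → g = 1 := by
    intro N g h h2 ho
    rcases (Nat.dvd_prime Nat.prime_two).1 h2 with h' | h'
    · exact h'
    · subst h'
      exact absurd (even_iff_two_dvd.2 h) (Nat.not_even_iff_odd.2 ho)
  constructor
  · set g := Nat.gcd (p ^ n - 1) ((p ^ (2 * k) + 1) / 2) with hg
    have g2 : g ∣ (p ^ (2 * k) + 1) / 2 := Nat.gcd_dvd_right _ _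
    have g3 : g ∣ p ^ (2 * k) + 1 := g2.trans (Nat.div_dvd_of_dvd (by omega))
    refine hpar _ g g2 (aux_two p n k g 2 hp.pos _ _ hns hab (Nat.gcd_dvd_left _ _) ?_)
      ⟨y * y + y, by omega⟩
    have h := (ZMod.natCast_eq_zero_iff _ _).2 g3
    push_cast at h
    rw [← pow_mul, mul_comm k 2]
    linear_combination h
  · set g := Nat.gcd (p ^ n - 1) (p ^ (2 * k) - p ^ k + 1) with hg
    have g2 : g ∣ p ^ (2 * k) - p ^ k + 1 := Nat.gcd_dvd_right _ _
    have hle : p ^ k ≤ p ^ (2 * k) := Nat.pow_le_pow_right hp.pos (by omega)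
    refine hpar _ g g2 (aux_two p n k g 3 hp.pos _ _ hns hab (Nat.gcd_dvd_left _ _) ?_)
      ⟨2 * (y * y + y) - y, by omega⟩
    have h := (ZMod.natCast_eq_zero_iff _ _).2 g2
    rw [Nat.cast_add, Nat.cast_sub hle] at h
    push_cast at h
    rw [mul_comm 2 k, pow_mul] at h
    linear_combination ((p : ZMod g) ^ k + 1) * h
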